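/- arXiv:1802.06440 — 6 statements merged into one kernel-verified Lean document; each statement's English description precedes it below -/
import Mathlib

section
/- Let a_0, …, a_m be an arbitrary sequence of reals and let b_0, …, b_n be a concave sequence of reals. Define the matrix A (indexed by i ∈ {0,…,m+n} and j ∈ {0,…,m+n}) over ℝ ∪ {-∞} by A_{i,j} = a_j + b_{i-j} if 0 ≤ j ≤ m and 0 ≤ i-j ≤ n, and A_{i,j} = -∞ otherwise. Then A satisfies the Monge inequality: for all i, j, A_{i,j} + A_{i+1,j+1} ≥ A_{i+1,j} + A_{i,j+1} (in ℝ ∪ {-∞}, where -∞ + x = -∞ and -∞ ≤ x for all x). -/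
/-- If `a` is an arbitrary real sequence (indices `0,…,m`) and `b` is a concave
real sequence (indices `0,…,n`), then the matrix `A` over `ℝ ∪ {-∞}` defined by
`A i j = a j + b (i - j)` when the indices are in range (and `-∞` otherwise) is Monge. -/
theorem stmt_0 (m n : ℕ) (a b : ℕ → ℝ)
    (hconc : ∀ i : ℕ, 1 ≤ i → i + 1 ≤ n → b i - b (i - 1) ≥ b (i + 1) - b i)
    (A : ℕ → ℕ → WithBot ℝ)
    (hA : ∀ i j : ℕ,
      A i j = if j ≤ m ∧ j ≤ i ∧ i - j ≤ n then ((a j + b (i - j) : ℝ) : WithBot ℝ) else ⊥) :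
    ∀ i j : ℕ, i + 1 ≤ m + n → j + 1 ≤ m + n →
      A i j + A (i + 1) (j + 1) ≥ A (i + 1) j + A i (j + 1) := by
  intro i j _ _
  by_cases h : j + 1 ≤ m ∧ j + 1 ≤ i ∧ i + 1 - j ≤ n
  · obtain ⟨hm, hji, hn⟩ := h
    obtain ⟨k, rfl⟩ := Nat.exists_eq_add_of_le hji
    have hb := hconc (k + 1) (by omega) (by omega)
    rw [hA, hA, hA, hA, if_pos (by omega), if_pos (by omega), if_pos (by omega),
      if_pos (by omega), show j + 1 + k - j = k + 1 by omega,
      show j + 1 + k + 1 - (j + 1) = k + 1 by omega,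
      show j + 1 + k + 1 - j = k + 1 + 1 by omega, show j + 1 + k - (j + 1) = k by omega]
    rw [Nat.add_sub_cancel] at hb
    norm_cast
    linarith
  · have hbot : A (i + 1) j + A i (j + 1) = ⊥ := by
      rw [WithBot.add_eq_bot, hA, hA]
      by_cases h' : j + 1 ≤ m ∧ j + 1 ≤ i ∧ i - (j + 1) ≤ n
      · exact Or.inl (if_neg (by omega))
      · exact Or.inr (if_neg h')
    rw [hbot]
    exact bot_le
end

section
/- Consider an unbounded knapsack instance with N items having positive integer weights w_1, …, w_N ∈ {1, …, M} and nonnegative real values v_1, …, v_N. For s ≥ 0 let a_s be the maximum total value of a finite multiset of items (items may be used any number of times) whose total weight is at most s (the empty multiset is allowed, so a_s ≥ 0). Then for every s ≥ 0, a_s = max { a_j + a_{s-j} : 0 ≤ j ≤ s and |2j − s| ≤ M }. -/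
/-- A multiset of items of weight at most `M` which fits into capacity `s` can be split into two
parts fitting into complementary capacities that differ by at most `M`. -/
theorem Multiset.exists_balanced_split {ι : Type*} {M : ℕ} (hM : 1 ≤ M) {w : ι → ℕ}
    (hw : ∀ i, w i ≤ M) (R : Multiset ι) :
    ∀ s : ℕ, (R.map w).sum ≤ s → ∃ A B : Multiset ι, ∃ j k : ℕ,
      A + B = R ∧ j + k = s ∧ (A.map w).sum ≤ j ∧ (B.map w).sum ≤ k ∧
        j ≤ k + M ∧ k ≤ j + M := by
  induction R using Multiset.induction_on with
  | empty =>
    intro s _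
    exact ⟨0, 0, s / 2, s - s / 2, by simp, by omega, by simp, by simp, by omega, by omega⟩
  | cons i R ih =>
    intro s hs
    rw [Multiset.map_cons, Multiset.sum_cons] at hs
    obtain ⟨A, B, j, k, hR, hjk, hA, hB, h₁, h₂⟩ := ih (s - w i) (by omega)
    have hi := hw i
    rcases le_total j k with h | h
    · refine ⟨i ::ₘ A, B, j + w i, k, by rw [Multiset.cons_add, hR], by omega, ?_, hB,
        by omega, by omega⟩
      rw [Multiset.map_cons, Multiset.sum_cons]
      omega
    · refine ⟨A, i ::ₘ B, j, k + w i, by rw [Multiset.add_cons, hR], by omega, hA, ?_,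
        by omega, by omega⟩
      rw [Multiset.map_cons, Multiset.sum_cons]
      omega

/-- For unbounded knapsack with weights `w i ∈ {1, …, M}` and nonnegative values,
letting `a s` be the optimal value at capacity `s` (maximum over finite multisets of items of
total weight at most `s`), we have `a s = max { a j + a (s - j) : 0 ≤ j ≤ s, |2j - s| ≤ M }`. -/
theorem stmt_7 (N M : ℕ) (hM : 1 ≤ M)
    (w : Fin N → ℕ) (v : Fin N → ℝ)
    (hw : ∀ i, 1 ≤ w i ∧ w i ≤ M) (hv : ∀ i, 0 ≤ v i)
    (a : ℕ → ℝ)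
    (ha : ∀ s : ℕ, IsGreatest
      {x : ℝ | ∃ R : Multiset (Fin N), (R.map w).sum ≤ s ∧ x = (R.map v).sum} (a s)) :
    ∀ s : ℕ, IsGreatest
      {x : ℝ | ∃ j : ℕ, j ≤ s ∧ |2 * (j : ℤ) - (s : ℤ)| ≤ (M : ℤ) ∧ x = a j + a (s - j)}
      (a s) := by
  intro s
  have superadditive : ∀ j ≤ s, a j + a (s - j) ≤ a s := by
    intro j hj
    obtain ⟨A, hA, hAv⟩ := (ha j).1
    obtain ⟨B, hB, hBv⟩ := (ha (s - j)).1
    refine (ha s).2 ⟨A + B, ?_, ?_⟩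
    · rw [Multiset.map_add, Multiset.sum_add]
      omega
    · rw [Multiset.map_add, Multiset.sum_add, hAv, hBv]
  constructor
  · obtain ⟨R, hR, hRv⟩ := (ha s).1
    obtain ⟨A, B, j, k, rfl, rfl, hA, hB, h₁, h₂⟩ :=
      R.exists_balanced_split hM (fun i => (hw i).2) s hR
    refine ⟨j, by omega, by rw [abs_le]; omega, le_antisymm ?_ (superadditive j (by omega))⟩
    rw [hRv, Multiset.map_add, Multiset.sum_add]
    exact add_le_add ((ha j).2 ⟨A, hA, rfl⟩) ((ha _).2 ⟨B, by omega, rfl⟩)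
  · rintro x ⟨j, hj, -, rfl⟩
    exact superadditive j hj
end

section
/- Consider an unbounded knapsack instance with items having positive integer weights in {1, …, M} and real values. Define v^{(0)} : {0, …, M} → ℝ ∪ {-∞} by v^{(0)}_0 = 0, and for x ≥ 1, v^{(0)}_x = the maximum value of an item of weight x (or -∞ if no item has weight x). For i ≥ 0 define v^{(i+1)}_x = max_{0 ≤ j ≤ x} ( v^{(i)}_j + v^{(i)}_{x-j} ) for x ∈ {0, …, M}. Then for every i ≥ 0 and every x ∈ {0, …, M}, v^{(i)}_x equals the maximum total value of a finite multiset of at most 2^i items (with repetition allowed) whose total weight is exactly x, and v^{(i)}_x = -∞ if no such multiset exists. -/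
/-- A multiset with at most `2 * n` elements splits into two with at most `n` elements each. -/
theorem Multiset.exists_add_eq_card_le {α : Type*} {n : ℕ} (R : Multiset α)
    (hR : Multiset.card R ≤ 2 * n) :
    ∃ S T : Multiset α, S + T = R ∧ Multiset.card S ≤ n ∧ Multiset.card T ≤ n := by
  induction R using Quotient.inductionOn with
  | h l =>
    refine ⟨(l.take n : Multiset α), (l.drop n : Multiset α), ?_, ?_, ?_⟩
    · simp
    · simp
    · simp at hR ⊢
      omega

/-- A number that bounds every solution value and is either `⊥` or attained is the optimum. -/
theorem isGreatest_and_eq_bot_of_le_of_attained {α : Type*} {P : α → Prop} {f : α → EReal}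
    {a : EReal} (hle : ∀ R, P R → f R ≤ a) (hatt : a = ⊥ ∨ ∃ R, P R ∧ a = f R)
    (hbot : ∀ R, f R ≠ ⊥) :
    ((∃ R, P R) → IsGreatest {y | ∃ R, P R ∧ y = f R} a) ∧ ((¬ ∃ R, P R) → a = ⊥) := by
  refine ⟨fun ⟨R, hR⟩ => ⟨?_, ?_⟩, fun h => ?_⟩
  · rcases hatt with rfl | hatt
    · exact absurd (le_bot_iff.mp (hle R hR)) (hbot R)
    · exact hatt
  · rintro _ ⟨S, hS, rfl⟩
    exact hle S hS
  · rcases hatt with h' | ⟨R, hR, -⟩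
    · exact h'
    · exact absurd ⟨R, hR⟩ h

/-- For unbounded knapsack with weights in `{1, …, M}` and real values, define
`v⁽⁰⁾ : {0,…,M} → ℝ ∪ {-∞}` by `v⁽⁰⁾ 0 = 0` and, for `x ≥ 1`, `v⁽⁰⁾ x` = the greatest value
of an item of weight `x` (`-∞`, i.e. `sSup ∅`, if none), and
`v⁽ⁱ⁺¹⁾ x = max_{0 ≤ j ≤ x} (v⁽ⁱ⁾ j + v⁽ⁱ⁾ (x - j))`. Then `v⁽ⁱ⁾ x` is the greatest total
value of a multiset of at most `2^i` items of total weight exactly `x`, and equals `-∞`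
when no such multiset exists. `ℝ ∪ {-∞}` is modeled inside `EReal`. -/
theorem stmt_8 (N M : ℕ) (w : Fin N → ℕ) (val : Fin N → ℝ)
    (hw : ∀ i, 1 ≤ w i ∧ w i ≤ M)
    (v : ℕ → ℕ → EReal)
    (hv0_zero : v 0 0 = 0)
    (hv0 : ∀ x : ℕ, 1 ≤ x → x ≤ M →
      v 0 x = sSup {y : EReal | ∃ i : Fin N, w i = x ∧ y = ((val i : ℝ) : EReal)})
    (hvsucc : ∀ i x : ℕ, x ≤ M →
      v (i + 1) x = ⨆ j ∈ Finset.range (x + 1), (v i j + v i (x - j))) :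
    ∀ i x : ℕ, x ≤ M →
      ((∃ R : Multiset (Fin N), Multiset.card R ≤ 2 ^ i ∧ (R.map w).sum = x) →
        IsGreatest {y : EReal | ∃ R : Multiset (Fin N),
          Multiset.card R ≤ 2 ^ i ∧ (R.map w).sum = x ∧ y = (((R.map val).sum : ℝ) : EReal)}
          (v i x)) ∧
      ((¬ ∃ R : Multiset (Fin N), Multiset.card R ≤ 2 ^ i ∧ (R.map w).sum = x) →
        v i x = ⊥) := by
  have key : ∀ i x : ℕ, x ≤ M →
      (∀ R : Multiset (Fin N), (Multiset.card R ≤ 2 ^ i ∧ (R.map w).sum = x) →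
        (((R.map val).sum : ℝ) : EReal) ≤ v i x) ∧
      (v i x = ⊥ ∨ ∃ R : Multiset (Fin N), (Multiset.card R ≤ 2 ^ i ∧ (R.map w).sum = x) ∧
        v i x = (((R.map val).sum : ℝ) : EReal)) := by
    intro i
    induction i with
    | zero =>
      intro x hx
      rcases Nat.eq_zero_or_pos x with rfl | hpos
      · refine ⟨?_, Or.inr ⟨0, by simp, by simp [hv0_zero]⟩⟩
        rintro R ⟨-, hR⟩
        have hR0 : R = 0 := by
          refine Multiset.eq_zero_of_forall_notMem fun a ha => ?_
          have := Multiset.single_le_sum (fun _ _ => Nat.zero_le _) _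
            (Multiset.mem_map_of_mem w ha)
          have := (hw a).1
          omega
        simp [hR0, hv0_zero]
      · rw [hv0 x hpos hx]
        constructor
        · rintro R ⟨hcard, hR⟩
          rcases Nat.le_one_iff_eq_zero_or_eq_one.mp (by simpa using hcard) with h | h
          · rw [Multiset.card_eq_zero] at h
            subst h
            simp at hR
            omega
          · obtain ⟨a, rfl⟩ := Multiset.card_eq_one.mp h
            exact le_sSup ⟨a, by simpa using hR, by simp⟩
        · set s : Set EReal := {y | ∃ i : Fin N, w i = x ∧ y = ((val i : ℝ) : EReal)}
          have hfin : s.Finite :=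
            (Set.finite_range fun i => ((val i : ℝ) : EReal)).subset <| by
              rintro _ ⟨a, -, rfl⟩
              exact ⟨a, rfl⟩
          rcases s.eq_empty_or_nonempty with he | hne
          · left
            rw [he, sSup_empty]
          · obtain ⟨a, ha, hval⟩ := hne.csSup_mem hfin
            exact Or.inr ⟨{a}, by simpa using ha, by simpa using hval⟩
    | succ i ih =>
      intro x hx
      rw [hvsucc i x hx]
      constructor
      · rintro R ⟨hcard, hR⟩
        obtain ⟨S, T, rfl, hS, hT⟩ := R.exists_add_eq_card_le (by rwa [pow_succ'] at hcard)
        rw [Multiset.map_add, Multiset.sum_add] at hR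
        have hSv := (ih (S.map w).sum (by omega)).1 S ⟨hS, rfl⟩
        have hTv := (ih (x - (S.map w).sum) (by omega)).1 T ⟨hT, by omega⟩
        rw [Multiset.map_add, Multiset.sum_add, EReal.coe_add]
        exact (add_le_add hSv hTv).trans <|
          le_iSup₂ (f := fun j (_ : j ∈ Finset.range (x + 1)) => v i j + v i (x - j))
            (S.map w).sum (Finset.mem_range.mpr (by omega))
      · rw [← Finset.sup_eq_iSup]
        obtain ⟨j, hj, heq⟩ := Finset.exists_mem_eq_sup (Finset.range (x + 1)) (by simp)
          fun j => v i j + v i (x - j)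
        rw [heq]
        rw [Finset.mem_range] at hj
        rcases (ih j (by omega)).2 with h | ⟨S, ⟨hS, hSw⟩, hSv⟩
        · simp [h]
        rcases (ih (x - j) (by omega)).2 with h | ⟨T, ⟨hT, hTw⟩, hTv⟩
        · simp [h]
        refine Or.inr ⟨S + T, ⟨?_, ?_⟩, ?_⟩
        · rw [Multiset.card_add, pow_succ']
          omega
        · rw [Multiset.map_add, Multiset.sum_add]
          omega
        · rw [Multiset.map_add, Multiset.sum_add, EReal.coe_add, hSv, hTv]
  intro i x hx
  simpa only [and_assoc] using isGreatest_and_eq_bot_of_le_of_attained (key i x hx).1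
    (key i x hx).2 fun _ => EReal.coe_ne_bot _
end

section
/- Let → be a transitive irreflexive relation on a finite vertex set V (a transitive DAG) satisfying property P: for every u_1, u_2, u_3 with u_1 → u_2 and u_2 → u_3, and every vertex v, either u_1 → v or v → u_3. Let s, t ∈ V, let P = (s = p_0, p_1, …, p_{k-1}, p_k = t) be a directed path from s to t with k edges, and let Q = (s = q_0, q_1, …, q_{k+1}, q_{k+2} = t) be a directed path from s to t with k+2 edges. Then there exist directed paths P' and Q' from s to t, each with exactly k+1 edges, such that the multiset of vertices of P' together with the multiset of vertices of Q' equals the multiset of vertices of P together with the multiset of vertices of Q. -/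
/-- If `p → b`, the paths `p :: P` and `a :: b :: Q` ending at `t` can be crossed over at some
point, moving one vertex from the second to the first. -/
theorem exists_crossover {V : Type*} {r : V → V → Prop} (htrans : Transitive r)
    (hpropP : ∀ u₁ u₂ u₃ v : V, r u₁ u₂ → r u₂ u₃ → r u₁ v ∨ r v u₃) {t : V} :
    ∀ (P Q : List V) (p a b : V), P ≠ [] → Q.length = P.length →
      (p :: P).IsChain r → (a :: b :: Q).IsChain r → r p b →
      P.getLast? = some t → Q.getLast? = some t →
      ∃ X Y : List V, (p :: X).IsChain r ∧ (a :: Y).IsChain r ∧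
        X.getLast? = some t ∧ Y.getLast? = some t ∧
        X.length = P.length + 1 ∧ Y.length = P.length ∧
        (↑X + ↑Y : Multiset V) = ↑P + ↑(b :: Q) := by
  intro P
  induction P with
  | nil => simp
  | cons p' P ih =>
    intro Q p a b _ hlen hP hQ hpb hPt hQt
    obtain _ | ⟨q', Q⟩ := Q
    · simp at hlen
    have hlen' : Q.length = P.length := by simpa using hlen
    simp only [List.isChain_cons_cons] at hP hQ
    obtain ⟨hpp', hP⟩ := hP
    obtain ⟨hab, hbq', hQ⟩ := hQ
    by_cases hap' : r a p'
    · refine ⟨b :: q' :: Q, p' :: P, ?_, ?_, ?_, hPt, by simp [hlen'], rfl, add_comm _ _⟩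
      · simp [List.isChain_cons_cons, *]
      · simp [List.isChain_cons_cons, *]
      · simpa using hQt
    · have hp'q' : r p' q' := (hpropP a b q' p' hab hbq').resolve_left hap'
      have hP0 : P ≠ [] := by
        rintro rfl
        obtain rfl : Q = [] := by simpa using hlen'
        obtain rfl : p' = t := by simpa using hPt
        obtain rfl : q' = p' := by simpa using hQt
        exact hap' (htrans hab hbq')
      have hQ0 : Q ≠ [] := by
        rintro rfl
        exact hP0 (List.length_eq_zero_iff.1 hlen'.symm)
      obtain ⟨X, Y, hX, hY, hXt, hYt, hXl, hYl, hXY⟩ :=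
        ih Q p' b q' hP0 hlen' hP (by simp [List.isChain_cons_cons, *]) hp'q'
          (by rwa [List.getLast?_cons_of_ne_nil hP0] at hPt)
          (by rwa [List.getLast?_cons_of_ne_nil hQ0] at hQt)
      refine ⟨p' :: X, b :: Y, ?_, ?_, ?_, ?_, by simp [hXl], by simp [hYl], ?_⟩
      · simp [List.isChain_cons_cons, *]
      · simp [List.isChain_cons_cons, *]
      · simp [List.getLast?_cons, hXt]
      · simp [List.getLast?_cons, hYt]
      · simp only [← Multiset.cons_coe, Multiset.cons_add, Multiset.add_cons] at hXY ⊢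
        rw [hXY, Multiset.cons_swap p' q' (↑P + ↑Q)]

/-- In a transitive DAG (a transitive irreflexive relation on a finite vertex set)
satisfying property P (for every path `u₁ → u₂ → u₃` and every vertex `v`, `u₁ → v` or
`v → u₃`), given a path `P` from `s` to `t` with `k` edges (`k+1` vertices) and a path `Q`
from `s` to `t` with `k+2` edges (`k+3` vertices), there are paths `P'` and `Q'` from `s` to
`t`, each with `k+1` edges, whose combined multiset of vertices equals that of `P` and `Q`. -/
theorem stmt_9 {V : Type*} [Fintype V] (r : V → V → Prop)
    (htrans : Transitive r) (hirrefl : Irreflexive r)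
    (hpropP : ∀ u₁ u₂ u₃ v : V, r u₁ u₂ → r u₂ u₃ → r u₁ v ∨ r v u₃)
    (s t : V) (k : ℕ) (P Q : List V)
    (hP : P.Chain' r ∧ P.head? = some s ∧ P.getLast? = some t ∧ P.length = k + 1)
    (hQ : Q.Chain' r ∧ Q.head? = some s ∧ Q.getLast? = some t ∧ Q.length = k + 3) :
    ∃ P' Q' : List V,
      (P'.Chain' r ∧ P'.head? = some s ∧ P'.getLast? = some t ∧ P'.length = k + 2) ∧
      (Q'.Chain' r ∧ Q'.head? = some s ∧ Q'.getLast? = some t ∧ Q'.length = k + 2) ∧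
      (↑P' + ↑Q' : Multiset V) = ↑P + ↑Q := by
  obtain ⟨hPc, hPs, hPt, hPl⟩ := hP
  obtain ⟨hQc, hQs, hQt, hQl⟩ := hQ
  obtain _ | ⟨p, P⟩ := P
  · simp at hPl
  obtain _ | ⟨q, _ | ⟨a, _ | ⟨b, Q⟩⟩⟩ := Q
  · simp at hQl
  · simp at hQl
  · simp at hQl
  obtain rfl : p = s := by simpa using hPs
  obtain rfl : q = p := by simpa using hQs
  have hlP : P.length = k := by simpa using hPl
  have hlQ : Q.length = k := by simpa using hQl
  obtain ⟨hqa, hQc'⟩ := List.isChain_cons_cons.1 hQc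
  have hab : r a b := (List.isChain_cons_cons.1 hQc').1
  have hqb : r q b := htrans hqa hab
  have hP0 : P ≠ [] := by
    rintro rfl
    obtain rfl : Q = [] := List.length_eq_zero_iff.1 (hlQ.trans hlP.symm)
    obtain rfl : q = t := by simpa using hPt
    obtain rfl : b = q := by simpa using hQt
    exact hirrefl b hqb
  have hQ0 : Q ≠ [] := by
    rintro rfl
    exact hP0 (List.length_eq_zero_iff.1 (hlP.trans hlQ.symm))
  obtain ⟨X, Y, hX, hY, hXt, hYt, hXl, hYl, hXY⟩ :=
    exists_crossover htrans hpropP P Q q a b hP0 (hlQ.trans hlP.symm) hPc hQc' hqb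
      (by rwa [List.getLast?_cons_of_ne_nil hP0] at hPt)
      (by simpa [List.getLast?_cons_of_ne_nil hQ0] using hQt)
  refine ⟨q :: X, q :: a :: Y, ⟨hX, rfl, ?_, by simp [hXl, hlP]⟩,
    ⟨List.isChain_cons_cons.2 ⟨hqa, hY⟩, rfl, ?_, by simp [hYl, hlP]⟩, ?_⟩
  · simp [List.getLast?_cons, hXt]
  · simp [List.getLast?_cons, hYt]
  · simp only [← Multiset.cons_coe, Multiset.cons_add, Multiset.add_cons] at hXY ⊢
    rw [hXY, Multiset.cons_swap q b]
end

section
/- Let → be a transitive irreflexive relation on a finite vertex set V (a transitive DAG) satisfying property P: for every u_1, u_2, u_3 with u_1 → u_2 and u_2 → u_3, and every vertex v, either u_1 → v or v → u_3. Fix vertices s, t and node weights val : V → ℝ, and for each j ≥ 1 for which a directed path from s to t with exactly j vertices exists, let f(j) be the maximum of Σ_{x on the path} val(x) over directed paths from s to t with exactly j vertices. Then for every k ≥ 2, if paths from s to t with exactly k vertices and with exactly k+2 vertices both exist, then a path with exactly k+1 vertices exists and 2·f(k+1) ≥ f(k) + f(k+2). -/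
/-- Exchanging tails: a path `a :: A` and a path `b₀ :: b₁ :: b₂ :: B` with two more vertices and the
same endpoint, with `a → b₂`, can be recombined into two paths of equal length with the same
starting points, endpoint and total reward. -/
theorem exists_balanced_paths {V : Type*} {r : V → V → Prop}
    (htrans : ∀ ⦃x y z : V⦄, r x y → r y z → r x z)
    (hpropP : ∀ u₁ u₂ u₃ v : V, r u₁ u₂ → r u₂ u₃ → r u₁ v ∨ r v u₃)
    (t : V) (val : V → ℝ) (A : List V) :
    ∀ (a b₀ b₁ b₂ : V) (B : List V), A ≠ [] → (a :: A).IsChain r →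
      (b₀ :: b₁ :: b₂ :: B).IsChain r → r a b₂ → A.length = B.length →
      (a :: A).getLast? = some t → (b₀ :: b₁ :: b₂ :: B).getLast? = some t →
      ∃ P Q : List V, (a :: P).IsChain r ∧ (b₀ :: Q).IsChain r ∧
        (a :: P).getLast? = some t ∧ (b₀ :: Q).getLast? = some t ∧
        P.length = A.length + 1 ∧ Q.length = A.length + 1 ∧
        (P.map val).sum + (Q.map val).sum =
          (A.map val).sum + ((b₁ :: b₂ :: B).map val).sum := by
  induction A with
  | nil => intro _ _ _ _ _ h; exact absurd rfl h
  | cons a' A ih =>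
    intro a b₀ b₁ b₂ B _ hA hB hab hlen hAt hBt
    obtain _ | ⟨b₃, B⟩ := B
    · simp at hlen
    simp only [List.isChain_cons_cons, List.length_cons, Nat.add_right_cancel_iff,
      List.getLast?_cons_cons] at hA hB hlen hAt hBt
    obtain ⟨haa, hA⟩ := hA
    obtain ⟨h01, h12, h23, hB⟩ := hB
    by_cases hcross : r b₁ a'
    · refine ⟨b₂ :: b₃ :: B, b₁ :: a' :: A, ?_, ?_, ?_, ?_, ?_, ?_, ?_⟩
      · simp [List.isChain_cons_cons, *]
      · simp [List.isChain_cons_cons, *]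
      · simpa only [List.getLast?_cons_cons] using hBt
      · simpa only [List.getLast?_cons_cons] using hAt
      · simp [hlen]
      · simp
      · simp only [List.map_cons, List.sum_cons]; ring
    · have h : r a' b₃ := (hpropP b₁ b₂ b₃ a' h12 h23).resolve_left hcross
      have hne : A ≠ [] := by
        rintro rfl
        obtain rfl : B = [] := List.length_eq_zero_iff.mp hlen.symm
        simp only [List.getLast?_singleton, Option.some.injEq] at hAt hBt
        subst hAt hBt
        exact hcross (htrans h12 h23)
      obtain ⟨P, Q, hP, hQ, hPt, hQt, hPl, hQl, hsum⟩ :=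
        ih a' b₁ b₂ b₃ B hne hA (by simp [List.isChain_cons_cons, *]) h hlen hAt
          (by simpa only [List.getLast?_cons_cons] using hBt)
      refine ⟨a' :: P, b₁ :: Q, ?_, ?_, ?_, ?_, ?_, ?_, ?_⟩
      · exact List.isChain_cons_cons.mpr ⟨haa, hP⟩
      · exact List.isChain_cons_cons.mpr ⟨h01, hQ⟩
      · rwa [List.getLast?_cons_cons]
      · rwa [List.getLast?_cons_cons]
      · simp [hPl]
      · simp [hQl]
      · simp only [List.map_cons, List.sum_cons] at hsum ⊢; linarith

/-- In a transitive DAG satisfying property P, with node weights `val` and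
`f j` the maximum reward of a directed path from `s` to `t` with exactly `j` vertices
(whenever such a path exists), for every `k ≥ 2`: if paths from `s` to `t` with exactly `k`
and exactly `k+2` vertices both exist, then a path with exactly `k+1` vertices exists and
`2 * f (k+1) ≥ f k + f (k+2)`. -/
theorem stmt_10 {V : Type*} [Fintype V] (r : V → V → Prop)
    (htrans : Transitive r) (hirrefl : Irreflexive r)
    (hpropP : ∀ u₁ u₂ u₃ v : V, r u₁ u₂ → r u₂ u₃ → r u₁ v ∨ r v u₃)
    (s t : V) (val : V → ℝ) (f : ℕ → ℝ)
    (hf : ∀ j : ℕ, 1 ≤ j →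
      (∃ l : List V, l.Chain' r ∧ l.head? = some s ∧ l.getLast? = some t ∧ l.length = j) →
      IsGreatest {x : ℝ | ∃ l : List V, l.Chain' r ∧ l.head? = some s ∧
        l.getLast? = some t ∧ l.length = j ∧ x = (l.map val).sum} (f j)) :
    ∀ k : ℕ, 2 ≤ k →
      (∃ l : List V, l.Chain' r ∧ l.head? = some s ∧ l.getLast? = some t ∧ l.length = k) →
      (∃ l : List V, l.Chain' r ∧ l.head? = some s ∧ l.getLast? = some t ∧ l.length = k + 2) →
      (∃ l : List V, l.Chain' r ∧ l.head? = some s ∧ l.getLast? = some t ∧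
        l.length = k + 1) ∧
      2 * f (k + 1) ≥ f k + f (k + 2) := by
  intro k hk hexk hexk2
  obtain ⟨A, hA, hAs, hAt, hAl, hAf⟩ := (hf k (by omega) hexk).1
  obtain ⟨B, hB, hBs, hBt, hBl, hBf⟩ := (hf (k + 2) (by omega) hexk2).1
  obtain _ | ⟨a, A⟩ := A
  · simp at hAs
  obtain _ | ⟨b₀, _ | ⟨b₁, _ | ⟨b₂, B⟩⟩⟩ := B
  iterate 3 · simp at hBl; try omega
  simp only [List.head?_cons, Option.some.injEq] at hAs hBs
  subst hAs hBs
  simp only [List.length_cons] at hAl hBl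
  have hB' : (b₀ :: b₁ :: b₂ :: B).IsChain r := hB
  simp only [List.isChain_cons_cons] at hB'
  obtain ⟨P, Q, hP, hQ, hPt, hQt, hPl, hQl, hsum⟩ :=
    exists_balanced_paths htrans hpropP t val A b₀ b₀ b₁ b₂ B
      (by rintro rfl; simp at hAl; omega) hA hB (htrans hB'.1 hB'.2.1) (by omega) hAt hBt
  have hex : ∃ l : List V, l.IsChain r ∧ l.head? = some b₀ ∧ l.getLast? = some t ∧
      l.length = k + 1 :=
    ⟨b₀ :: P, hP, rfl, hPt, by simp only [List.length_cons]; omega⟩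
  have hmax := (hf (k + 1) (by omega) hex).2
  have hPf := hmax ⟨b₀ :: P, hP, rfl, hPt, by simp only [List.length_cons]; omega, rfl⟩
  have hQf := hmax ⟨b₀ :: Q, hQ, rfl, hQt, by simp only [List.length_cons]; omega, rfl⟩
  refine ⟨hex, ?_⟩
  simp only [List.map_cons, List.sum_cons] at hAf hBf hPf hQf hsum
  linarith
end

section
/- Let → be a transitive irreflexive relation on a finite vertex set V (a transitive DAG) for which property P fails, i.e., there exist u_1 → u_2 → u_3 and a vertex v with neither u_1 → v nor v → u_3. Then there exist node weights val : V → ℝ such that, with g(j) defined as the maximum of Σ_{x on the path} val(x) over all directed paths (with arbitrary endpoints) having exactly j vertices, we have 2·g(2) < g(1) + g(3); in particular g is not concave. -/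
/-- If a transitive DAG fails property P, witnessed by a path `u₁ → u₂ → u₃`
and a vertex `v` with neither `u₁ → v` nor `v → u₃`, then there are node weights `val` such
that, with `g j` the maximum reward over all directed paths with exactly `j` vertices
(arbitrary endpoints), `2 * g 2 < g 1 + g 3`; in particular `g` is not concave. -/
theorem stmt_11 {V : Type*} [Fintype V] (r : V → V → Prop)
    (htrans : Transitive r) (hirrefl : Irreflexive r)
    (u₁ u₂ u₃ v : V) (h12 : r u₁ u₂) (h23 : r u₂ u₃)
    (h1v : ¬ r u₁ v) (hv3 : ¬ r v u₃) :
    ∃ val : V → ℝ, ∀ g₁ g₂ g₃ : ℝ,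
      IsGreatest {x : ℝ | ∃ l : List V, l.Chain' r ∧ l.length = 1 ∧ x = (l.map val).sum} g₁ →
      IsGreatest {x : ℝ | ∃ l : List V, l.Chain' r ∧ l.length = 2 ∧ x = (l.map val).sum} g₂ →
      IsGreatest {x : ℝ | ∃ l : List V, l.Chain' r ∧ l.length = 3 ∧ x = (l.map val).sum} g₃ →
      2 * g₂ < g₁ + g₃ := by
  classical
  have h13 : r u₁ u₃ := htrans h12 h23
  have n1 : u₁ ≠ v := by rintro rfl; exact hv3 h13
  have n2 : u₂ ≠ v := by rintro rfl; exact h1v h12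
  have n3 : u₃ ≠ v := by rintro rfl; exact h1v h13
  -- `v` is incomparable to `u₁`, `u₂`, `u₃`, so every edge has weight at most `2`.
  have hv1 : ¬ r v u₁ := fun h => hv3 (htrans h h13)
  have hv2 : ¬ r v u₂ := fun h => hv3 (htrans h h23)
  have h2v : ¬ r u₂ v := fun h => h1v (htrans h12 h)
  have h3v : ¬ r u₃ v := fun h => h1v (htrans h13 h)
  have hvv : ¬ r v v := hirrefl v
  let val : V → ℝ := fun x => if x = v then 2 else if x = u₁ ∨ x = u₂ ∨ x = u₃ then 1 else 0
  have val_add_le : ∀ a b, r a b → val a + val b ≤ 2 := by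
    intro a b hab
    simp only [val]
    split_ifs
    all_goals grind
  refine ⟨val, fun g₁ g₂ g₃ hg₁ hg₂ hg₃ => ?_⟩
  have le_g₁ : 2 ≤ g₁ := hg₁.2 ⟨[v], List.isChain_singleton v, by simp, by simp [val]⟩
  have le_g₃ : 3 ≤ g₃ :=
    hg₃.2 ⟨[u₁, u₂, u₃], List.isChain_cons_cons.mpr ⟨h12, List.isChain_pair.mpr h23⟩, by simp, by
      simp [val, n1, n2, n3]; norm_num⟩
  have g₂_le : g₂ ≤ 2 := by
    obtain ⟨l, hl, hlen, rfl⟩ := hg₂.1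
    obtain ⟨a, b, rfl⟩ := List.length_eq_two.mp hlen
    simpa using val_add_le a b (List.isChain_pair.mp hl)
  linarith
end
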